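/- The ambiguity satisfies A(R) ≤ 4·log₂ e(R), where e(R) is the number of linear extensions of the interval order induced by R. -/

import Mathlib

open scoped Classical

/-- The open interval family member `i` is `Set.Ioo (l i) (r i)`.
The contact set of `R_i` under the (identity) processing order:
indices `j ≤ i` whose interval intersects `R_i`. -/
noncomputable def contact (n : ℕ) (l r : Fin n → ℝ) (i : Fin n) : Finset (Fin n) :=
  Finset.univ.filter
    (fun j : Fin n => j ≤ i ∧ (Set.Ioo (l j) (r j) ∩ Set.Ioo (l i) (r i)).Nonempty)

/-- The π-ambiguity of the family (already relabeled in processing order). -/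
noncomputable def piAmbiguity (n : ℕ) (l r : Fin n → ℝ) : ℝ :=
  ∑ i : Fin n, Real.logb 2 ((contact n l r i).card : ℝ)

/-- A processing order (given as the relabeled family) is containment-compatible if
whenever `R_i ⊂ R_j` (proper subset) then `i < j`. -/
def ContainmentCompatible (n : ℕ) (l r : Fin n → ℝ) : Prop :=
  ∀ i j : Fin n, Set.Ioo (l i) (r i) ⊂ Set.Ioo (l j) (r j) → i < j

/-- The ambiguity: the minimum of the π-ambiguity over all processing orders. -/
noncomputable def ambiguity (n : ℕ) (l r : Fin n → ℝ) : ℝ :=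
  ⨅ π : Equiv.Perm (Fin n), piAmbiguity n (l ∘ π) (r ∘ π)

/-- Combinatorial equivalence of two indexed families of nonempty bounded open
intervals: `R_i` lies entirely to the left of `R_j` iff `I_i` lies entirely to
the left of `I_j`. -/
def CombEquiv {ι : Type*} (l r l' r' : ι → ℝ) : Prop :=
  ∀ i j : ι, (r i ≤ l j ↔ r' i ≤ l' j)

/-- `intervalE l r lam = E(R, λ)`: the supremum of `∑ log₂ |I_i|` over families of
open subintervals of `(0, λ)` combinatorially equivalent to `R`. -/
noncomputable def intervalE {ι : Type*} [Fintype ι] (l r : ι → ℝ) (lam : ℝ) : ℝ :=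
  sSup { x : ℝ | ∃ l' r' : ι → ℝ,
    (∀ i, 0 ≤ l' i ∧ l' i < r' i ∧ r' i ≤ lam) ∧
    CombEquiv l r l' r' ∧ x = ∑ i, Real.logb 2 (r' i - l' i) }

/-- The interval entropy `H(R) = E(R, n)/n`. -/
noncomputable def intervalEntropy (n : ℕ) (l r : Fin n → ℝ) : ℝ :=
  intervalE l r (n : ℝ) / (n : ℝ)

/-- The number of linear extensions of the interval order induced by `R`
(`i ≺ j` iff `r i ≤ l j`), counted via ranking permutations. -/
noncomputable def numLinExt (n : ℕ) (l r : Fin n → ℝ) : ℕ :=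
  Fintype.card {σ : Equiv.Perm (Fin n) // ∀ i j : Fin n, r i ≤ l j → σ i < σ j}

section AmbiguityBound

open Finset

/-! ### Product weights on finite families -/

/-- The expectation of `F` under the product of the weights `μ i`. -/
noncomputable def productMean {ι C : Type*} [Fintype ι] [DecidableEq ι] [Fintype C] (μ : ι → C → ℝ)
    (F : (ι → C) → ℝ) : ℝ :=
  ∑ x : ι → C, (∏ i, μ i (x i)) * F x

section ProductMean

variable {ι C : Type*} [Fintype ι] [DecidableEq ι] [Fintype C] {μ : ι → C → ℝ}

lemma sum_prod_apply_eq_prod_sum (f : ι → C → ℝ) :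
    ∑ x : ι → C, ∏ i, f i (x i) = ∏ i, ∑ c, f i c := by
  rw [Finset.prod_univ_sum, Fintype.piFinset_univ]

lemma sum_prod_weight_eq_one (h1 : ∀ i, ∑ c, μ i c = 1) :
    ∑ x : ι → C, ∏ i, μ i (x i) = 1 := by
  simp [sum_prod_apply_eq_prod_sum, h1]

lemma productMean_mono (h0 : ∀ i c, 0 ≤ μ i c) {F G : (ι → C) → ℝ} (h : ∀ x, F x ≤ G x) :
    productMean μ F ≤ productMean μ G :=
  sum_le_sum fun x _ => mul_le_mul_of_nonneg_left (h x) (prod_nonneg fun i _ => h0 i _)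

lemma productMean_const (h1 : ∀ i, ∑ c, μ i c = 1) (a : ℝ) :
    productMean μ (fun _ => a) = a := by
  rw [productMean, ← sum_mul, sum_prod_weight_eq_one h1, one_mul]

lemma productMean_add (F G : (ι → C) → ℝ) :
    productMean μ (fun x => F x + G x) = productMean μ F + productMean μ G := by
  simp [productMean, mul_add, sum_add_distrib]

lemma productMean_const_mul (a : ℝ) (F : (ι → C) → ℝ) :
    productMean μ (fun x => a * F x) = a * productMean μ F := by
  simp only [productMean, mul_sum]
  exact sum_congr rfl fun x _ => by ring

lemma productMean_sum {κ : Type*} (s : Finset κ) (F : κ → (ι → C) → ℝ) :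
    productMean μ (fun x => ∑ k ∈ s, F k x) = ∑ k ∈ s, productMean μ (F k) := by
  simp only [productMean, mul_sum]
  exact sum_comm

/-- Jensen's inequality for the logarithm. -/
lemma productMean_log_le (h0 : ∀ i c, 0 ≤ μ i c) (h1 : ∀ i, ∑ c, μ i c = 1)
    {F : (ι → C) → ℝ} (hF : ∀ x, 0 < F x) :
    productMean μ (fun x => Real.log (F x)) ≤ Real.log (productMean μ F) := by
  have := strictConcaveOn_log_Ioi.concaveOn.le_map_sum (t := univ)
    (w := fun x : ι → C => ∏ i, μ i (x i)) (p := F)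
    (fun x _ => prod_nonneg fun i _ => h0 i _) (sum_prod_weight_eq_one h1) (fun x _ => hF x)
  simpa [productMean] using this

/-- Resampling one coordinate does not change the mean. -/
lemma productMean_eq_productMean_update (h1 : ∀ i, ∑ c, μ i c = 1) (i : ι)
    (F : (ι → C) → ℝ) :
    productMean μ F = productMean μ (fun x => ∑ c, μ i c * F (Function.update x i c)) := by
  have hinv : Function.Involutive
      (fun p : (ι → C) × C => (Function.update p.1 i p.2, p.1 i)) := by
    rintro ⟨x, c⟩
    simp
  have hL : productMean μ F = ∑ p : (ι → C) × C, (∏ k, μ k (p.1 k)) * μ i p.2 * F p.1 := by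
    rw [Fintype.sum_prod_type, productMean]
    refine sum_congr rfl fun x _ => ?_
    simp only
    rw [← sum_mul, ← mul_sum, h1, mul_one]
  rw [hL, ← Equiv.sum_comp hinv.toPerm, Fintype.sum_prod_type, productMean]
  refine sum_congr rfl fun x _ => ?_
  rw [mul_sum]
  refine sum_congr rfl fun c _ => ?_
  simp only [Function.Involutive.coe_toPerm]
  rw [← mul_prod_erase univ (fun k => μ k (Function.update x i c k)) (mem_univ i),
    ← mul_prod_erase univ (fun k => μ k (x k)) (mem_univ i)]
  have : ∏ k ∈ univ.erase i, μ k (Function.update x i c k) = ∏ k ∈ univ.erase i, μ k (x k) :=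
    prod_congr rfl fun k hk => by rw [Function.update_of_ne (ne_of_mem_erase hk)]
  rw [this, Function.update_self]
  ring

/-- Independent coordinates: the probability that all coordinates in `B` avoid a value. -/
lemma productMean_forall_ne (h1 : ∀ i, ∑ c, μ i c = 1) (B : Finset ι) (v : ι → C) (p : ℝ)
    (hp : ∀ i ∈ B, μ i (v i) = p) :
    productMean μ (fun x => if ∀ h ∈ B, x h ≠ v h then 1 else 0) = (1 - p) ^ #B := by
  have key : ∀ x : ι → C, (∏ i, μ i (x i)) * (if ∀ h ∈ B, x h ≠ v h then (1 : ℝ) else 0)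
      = ∏ i, μ i (x i) * (if i ∈ B → x i ≠ v i then 1 else 0) := by
    intro x
    rw [prod_mul_distrib]
    congr 1
    rw [Finset.prod_boole]
    simp
  rw [productMean, sum_congr rfl fun x _ => key x,
    sum_prod_apply_eq_prod_sum fun i c => μ i c * (if i ∈ B → c ≠ v i then 1 else 0)]
  have hfac : ∀ i, ∑ c, μ i c * (if i ∈ B → c ≠ v i then 1 else 0)
      = if i ∈ B then 1 - p else 1 := by
    intro i
    by_cases hi : i ∈ B
    · simp only [hi, true_imp_iff, if_true]
      simp only [mul_ite, mul_one, mul_zero]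
      rw [← sum_filter, ← hp i hi, ← h1 i, ← sum_erase_eq_sub (mem_univ _)]
      congr 1
      ext c
      simp
    · simp [hi, h1]
  rw [prod_congr rfl fun i _ => hfac i, Finset.prod_ite_mem]
  simp

end ProductMean

/-- If each factor depends only on the coordinates up to its index and sums to at most one
over its last coordinate, the total sum of the products is at most one. -/
lemma sum_prod_adapted_le_one {C : Type*} [Fintype C] [Nonempty C] :
    ∀ (n : ℕ) (f : Fin n → (Fin n → C) → ℝ), (∀ i x, 0 ≤ f i x) →
      (∀ i x y, (∀ j ≤ i, x j = y j) → f i x = f i y) →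
      (∀ i x, ∑ c, f i (Function.update x i c) ≤ 1) →
      ∑ x : Fin n → C, ∏ i, f i x ≤ 1
  | 0, f, _, _, _ => by simp
  | n + 1, f, h0, hdep, hsum => by
    obtain ⟨c₀⟩ := ‹Nonempty C›
    have hcast : ∀ (i : Fin n) (x : Fin n → C) (c d : C),
        f i.castSucc (Fin.snoc x c) = f i.castSucc (Fin.snoc x d) := by
      intro i x c d
      refine hdep _ _ _ fun j hj => ?_
      have hj' : (j : ℕ) < n := lt_of_le_of_lt hj i.isLt
      simp [Fin.snoc, hj']
    have ih := sum_prod_adapted_le_one n (fun i x => f i.castSucc (Fin.snoc x c₀))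
      (fun i x => h0 _ _)
      (fun i x y hxy => hdep _ _ _ fun j hj => by
        have hj' : (j : ℕ) < n := lt_of_le_of_lt hj i.isLt
        simpa [Fin.snoc, hj', Fin.castLT] using hxy ⟨j, hj'⟩ hj)
      (fun i x => by
        have := hsum i.castSucc (Fin.snoc x c₀)
        simpa only [Fin.snoc_update] using this)
    rw [← Equiv.sum_comp (Fin.snocEquiv fun _ => C), Fintype.sum_prod_type_right]
    refine le_trans (sum_le_sum fun x _ => ?_) ih
    have hlast : ∑ c, f (Fin.last n) (Fin.snoc x c) ≤ 1 := by
      have := hsum (Fin.last n) (Fin.snoc x c₀)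
      simpa only [Fin.update_snoc_last] using this
    calc ∑ c, ∏ i, f i (Fin.snocEquiv (fun _ => C) (c, x))
        = ∑ c, (∏ i : Fin n, f i.castSucc (Fin.snoc x c₀)) * f (Fin.last n) (Fin.snoc x c) := by
          refine sum_congr rfl fun c _ => ?_
          rw [Fin.prod_univ_castSucc]
          congr 1
          exact prod_congr rfl fun i _ => hcast i x c c₀
      _ ≤ _ := by
          rw [← mul_sum]
          exact mul_le_of_le_one_right (prod_nonneg fun i _ => h0 _ _) hlast

/-! ### A geometric sum over ranks -/

lemma sum_pow_le_of_injOn {ι : Type*} (S : Finset ι) (c : ι → ℕ) (hinj : Set.InjOn c S)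
    (hpos : ∀ k ∈ S, 1 ≤ c k) : ∑ k ∈ S, (5 / 8 : ℝ) ^ c k ≤ 5 / 3 := by
  rw [← sum_image (f := fun m : ℕ => (5 / 8 : ℝ) ^ m) hinj]
  have h0 : 0 ∉ S.image c := by
    simp only [mem_image, not_exists, not_and]
    intro k hk h
    have := hpos k hk
    omega
  have hsum := (summable_geometric_of_lt_one (r := (5 / 8 : ℝ)) (by norm_num)
    (by norm_num)).sum_le_tsum (insert 0 (S.image c)) (fun m _ => by positivity)
  rw [sum_insert h0, tsum_geometric_of_lt_one (by norm_num) (by norm_num)] at hsum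
  norm_num at hsum ⊢
  linarith

/-- The members of `G` whose value separates those of `j` and `k`. -/
noncomputable def separators {ι : Type*} (G : Finset ι) (q : ι → ℕ) (j k : ι) : Finset ι :=
  G.filter fun h => ¬(q j < q h ↔ q k < q h)

lemma sum_pow_card_separators_le {ι : Type*} (G : Finset ι) (q : ι → ℕ)
    (hq : Set.InjOn q G) {j : ι} (hj : j ∈ G) :
    ∑ k ∈ G, (5 / 8 : ℝ) ^ #(separators G q j k) ≤ 13 / 3 := by
  have hright : ∑ k ∈ G with q j < q k, (5 / 8 : ℝ) ^ #(separators G q j k) ≤ 5 / 3 := by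
    have hlt : ∀ k ∈ G, ∀ k' ∈ G, q j < q k → q k < q k' →
        #(separators G q j k) < #(separators G q j k') := by
      intro k hk k' hk' h1 h2
      refine card_lt_card ((ssubset_iff_of_subset fun h hh => ?_).2 ⟨k', ?_, ?_⟩)
      · simp only [separators, mem_filter] at hh ⊢
        exact ⟨hh.1, by have := hh.2; omega⟩
      · simp only [separators, mem_filter]
        exact ⟨hk', by omega⟩
      · simp only [separators, mem_filter, not_and]
        intro _
        omega
    refine sum_pow_le_of_injOn _ _ ?_ ?_
    · intro k hk k' hk' h
      simp only [coe_filter, Set.mem_ofPred_eq] at hk hk'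
      refine hq hk.1 hk'.1 ?_
      simp only at h
      rcases lt_trichotomy (q k) (q k') with h' | h' | h'
      · have := hlt k hk.1 k' hk'.1 hk.2 h'
        omega
      · exact h'
      · have := hlt k' hk'.1 k hk.1 hk'.2 h'
        omega
    · intro k hk
      rw [mem_filter] at hk
      refine card_pos.2 ⟨k, ?_⟩
      simp only [separators, mem_filter]
      exact ⟨hk.1, by omega⟩
  have hleft : ∑ k ∈ G with q k < q j, (5 / 8 : ℝ) ^ #(separators G q j k) ≤ 5 / 3 := by
    have hlt : ∀ k ∈ G, ∀ k' ∈ G, q k' < q j → q k < q k' →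
        #(separators G q j k') < #(separators G q j k) := by
      intro k hk k' hk' h1 h2
      refine card_lt_card ((ssubset_iff_of_subset fun h hh => ?_).2 ⟨k', ?_, ?_⟩)
      · simp only [separators, mem_filter] at hh ⊢
        exact ⟨hh.1, by have := hh.2; omega⟩
      · simp only [separators, mem_filter]
        exact ⟨hk', by omega⟩
      · simp only [separators, mem_filter, not_and]
        intro _
        omega
    refine sum_pow_le_of_injOn _ _ ?_ ?_
    · intro k hk k' hk' h
      simp only [coe_filter, Set.mem_ofPred_eq] at hk hk'
      refine hq hk.1 hk'.1 ?_
      simp only at h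
      rcases lt_trichotomy (q k) (q k') with h' | h' | h'
      · have := hlt k hk.1 k' hk'.1 hk'.2 h'
        omega
      · exact h'
      · have := hlt k' hk'.1 k hk.1 hk.2 h'
        omega
    · intro k hk
      rw [mem_filter] at hk
      refine card_pos.2 ⟨j, ?_⟩
      simp only [separators, mem_filter]
      exact ⟨hj, by omega⟩
  have hmid : ∑ k ∈ G with q k = q j, (5 / 8 : ℝ) ^ #(separators G q j k) = 1 := by
    have : G.filter (fun k => q k = q j) = {j} := by
      ext k
      simp only [mem_filter, mem_singleton]
      exact ⟨fun h => hq h.1 hj h.2, by rintro rfl; exact ⟨hj, rfl⟩⟩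
    rw [this, sum_singleton]
    simp [separators]
  have hsplit : ∑ k ∈ G, (5 / 8 : ℝ) ^ #(separators G q j k)
      = ∑ k ∈ G with q j < q k, (5 / 8 : ℝ) ^ #(separators G q j k)
        + (∑ k ∈ G with q k < q j, (5 / 8 : ℝ) ^ #(separators G q j k)
        + ∑ k ∈ G with q k = q j, (5 / 8 : ℝ) ^ #(separators G q j k)) := by
    simp only [sum_filter, ← sum_add_distrib]
    refine sum_congr rfl fun k _ => ?_
    rcases lt_trichotomy (q k) (q j) with h | h | h
    · simp [h, h.ne, not_lt.2 h.le]
    · simp [h]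
    · simp [h, h.ne', not_lt.2 h.le]
  rw [hsplit]
  linarith

/-! ### Numerical estimate -/

lemma quarter_log_le (m : ℕ) (hm : 1 ≤ m) (T : ℝ) (h1 : T ≤ Real.log m)
    (h2 : T ≤ Real.log (13 / 3)) :
    Real.log m / 4 ≤ 3 / 4 * (1 - (5 / 8) ^ (m - 1)) * Real.log 2 + (Real.log m - T) / 4 := by
  have hl2 : 0 < Real.log 2 := Real.log_pos (by norm_num)
  have hlog3 : 5 * Real.log 3 ≤ 8 * Real.log 2 := by
    have := Real.log_le_log (x := 3 ^ 5) (y := 2 ^ 8) (by norm_num) (by norm_num)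
    rw [Real.log_pow, Real.log_pow] at this
    exact_mod_cast this
  have hlog13 : 4 * Real.log (13 / 3) ≤ 9 * Real.log 2 := by
    have := Real.log_le_log (x := (13 / 3) ^ 4) (y := 2 ^ 9) (by norm_num) (by norm_num)
    rw [Real.log_pow, Real.log_pow] at this
    exact_mod_cast this
  rcases Nat.lt_or_ge m 4 with h | h
  · interval_cases m
    · norm_num at h1 ⊢
      linarith
    · norm_num at h1 ⊢
      linarith
    · norm_num at h1 ⊢
      linarith
  · have hpow : (5 / 8 : ℝ) ^ (m - 1) ≤ (5 / 8) ^ 3 :=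
      pow_le_pow_of_le_one (by norm_num) (by norm_num) (by omega)
    have : 3 / 4 * (1 - (5 / 8 : ℝ) ^ 3) * Real.log 2
        ≤ 3 / 4 * (1 - (5 / 8) ^ (m - 1)) * Real.log 2 := by
      gcongr
    norm_num at this
    linarith

/-! ### Random linear extensions from endpoint ranks -/

/-- Natural-number endpoints `a i < b i` of intervals, all distinct, listed by increasing
length. -/
structure SortedEndpoints {n : ℕ} (a b : Fin n → ℕ) : Prop where
  lt : ∀ i, a i < b i
  inj_left : Function.Injective a
  inj_right : Function.Injective b
  left_ne_right : ∀ i j, a i ≠ b j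
  mono : ∀ i j, i ≤ j → b i + a j ≤ b j + a i

variable {n : ℕ} {a b : Fin n → ℕ}

/-- The indices up to `i` whose intervals meet the `i`-th one. -/
noncomputable def earlierOverlaps (a b : Fin n → ℕ) (i : Fin n) : Finset (Fin n) :=
  univ.filter fun j => j ≤ i ∧ a j < b i ∧ a i < b j

/-- An endpoint of the `j`-th interval lying inside the `i`-th one; the left endpoint of the
`i`-th interval itself if there is none to choose. -/
noncomputable def innerEnd (a b : Fin n → ℕ) (i j : Fin n) : ℕ :=
  if j ∈ earlierOverlaps a b i ∧ j ≠ i then (if a i < a j then a j else b j) else a i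

/-- The possible positions of the point representing the `i`-th interval: its left endpoint, its
right endpoint, or right after one of the inner endpoints. -/
noncomputable def pointPos (a b : Fin n → ℕ) (i : Fin n) : Bool ⊕ Fin n → ℕ
  | .inl true => (n + 1) * a i
  | .inl false => (n + 1) * b i
  | .inr j => (n + 1) * innerEnd a b i j + (i + 1)

/-- The probabilities of the positions in `pointPos`. -/
noncomputable def pointWeight (a b : Fin n → ℕ) (i : Fin n) : Bool ⊕ Fin n → ℝ
  | .inl _ => 3 / 8
  | .inr j => if j ∈ earlierOverlaps a b i then 1 / (4 * #(earlierOverlaps a b i)) else 0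

/-- The choice placing the point of the `j`-th interval at its endpoint inside the `i`-th one. -/
noncomputable def innerChoice (a : Fin n → ℕ) (i j : Fin n) : Bool ⊕ Fin n :=
  .inl (decide (a i < a j))

/-- The earlier intervals whose points sit at their endpoints inside the `i`-th interval. -/
noncomputable def hits (a b : Fin n → ℕ) (i : Fin n) (x : Fin n → Bool ⊕ Fin n) :
    Finset (Fin n) :=
  ((earlierOverlaps a b i).erase i).filter fun j => x j = innerChoice a i j

/-- The inner endpoints not separated from the `j`-th one by a hit. -/
noncomputable def cell (a b : Fin n → ℕ) (i : Fin n) (x : Fin n → Bool ⊕ Fin n) (j : Fin n) :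
    Finset (Fin n) :=
  (earlierOverlaps a b i).filter fun k =>
    ∀ h ∈ hits a b i x, innerEnd a b i j < innerEnd a b i h ↔ innerEnd a b i k < innerEnd a b i h

/-- A lower bound for the inverse probability of the position of the `i`-th point relative to the
hits. -/
noncomputable def gain (a b : Fin n → ℕ) (i : Fin n) (x : Fin n → Bool ⊕ Fin n) :
    Bool ⊕ Fin n → ℝ
  | .inl _ => if hits a b i x = ∅ then 1 else 2
  | .inr j => if j ∈ earlierOverlaps a b i then
      (#(earlierOverlaps a b i) : ℝ) / #(cell a b i x j) else 1

lemma mem_earlierOverlaps {i j : Fin n} :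
    j ∈ earlierOverlaps a b i ↔ j ≤ i ∧ a j < b i ∧ a i < b j := by
  simp [earlierOverlaps]

lemma pointWeight_nonneg (i : Fin n) (c : Bool ⊕ Fin n) : 0 ≤ pointWeight a b i c := by
  rcases c with s | j
  · norm_num [pointWeight]
  · simp only [pointWeight]
    split_ifs <;> positivity

lemma hits_congr {i : Fin n} {x y : Fin n → Bool ⊕ Fin n} (h : ∀ j < i, x j = y j) :
    hits a b i x = hits a b i y := by
  refine filter_congr fun j hj => ?_
  rw [mem_erase, mem_earlierOverlaps] at hj
  rw [h j (lt_of_le_of_ne hj.2.1 hj.1)]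

lemma gain_congr {i : Fin n} {x y : Fin n → Bool ⊕ Fin n} (h : ∀ j < i, x j = y j) :
    gain a b i x = gain a b i y := by
  funext c
  rcases c with s | j <;> simp only [gain, cell, hits_congr h]

lemma gain_update (i : Fin n) (x : Fin n → Bool ⊕ Fin n) (c : Bool ⊕ Fin n) :
    gain a b i (Function.update x i c) = gain a b i x :=
  gain_congr fun _ hj => Function.update_of_ne hj.ne _ _

lemma self_mem_cell {i j : Fin n} (x : Fin n → Bool ⊕ Fin n) (hj : j ∈ earlierOverlaps a b i) :
    j ∈ cell a b i x j := by
  simp [cell, hj]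

lemma gain_pos (i : Fin n) (x : Fin n → Bool ⊕ Fin n) (c : Bool ⊕ Fin n) :
    0 < gain a b i x c := by
  rcases c with s | j
  · simp only [gain]
    split_ifs <;> norm_num
  · simp only [gain]
    split_ifs with h
    · have h1 : 0 < #(earlierOverlaps a b i) := card_pos.2 ⟨j, h⟩
      have h2 : 0 < #(cell a b i x j) := card_pos.2 ⟨j, self_mem_cell x h⟩
      positivity
    · norm_num

lemma pointPos_of_mem_hits {i h : Fin n} {x : Fin n → Bool ⊕ Fin n} (hh : h ∈ hits a b i x) :
    h ∈ earlierOverlaps a b i ∧ h ≠ i ∧ pointPos a b h (x h) = (n + 1) * innerEnd a b i h := by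
  simp only [hits, mem_filter, mem_erase] at hh
  refine ⟨hh.1.2, hh.1.1, ?_⟩
  rw [hh.2, innerChoice]
  simp only [innerEnd, hh.1.1, hh.1.2, ne_eq, not_false_eq_true, and_self, if_true]
  by_cases h' : a i < a h <;> simp [h', pointPos]

namespace SortedEndpoints

lemma self_mem (H : SortedEndpoints a b) (i : Fin n) : i ∈ earlierOverlaps a b i :=
  mem_earlierOverlaps.2 ⟨le_rfl, H.lt i, H.lt i⟩

lemma innerEnd_mem (H : SortedEndpoints a b) {i j : Fin n} (hj : j ∈ earlierOverlaps a b i) (hne : j ≠ i) :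
    a i < innerEnd a b i j ∧ innerEnd a b i j < b i := by
  obtain ⟨h1, h2, h3⟩ := mem_earlierOverlaps.1 hj
  have hm := H.mono j i h1
  have hi := H.inj_left.ne hne
  simp only [innerEnd, hj, hne, ne_eq, not_false_eq_true, and_self, if_true]
  split_ifs with h
  · exact ⟨h, h2⟩
  · exact ⟨h3, by omega⟩

lemma innerEnd_bounds (H : SortedEndpoints a b) (i j : Fin n) : a i ≤ innerEnd a b i j ∧ innerEnd a b i j < b i := by
  by_cases h : j ∈ earlierOverlaps a b i ∧ j ≠ i
  · exact (H.innerEnd_mem h.1 h.2).imp_left le_of_lt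
  · simp [innerEnd, h, H.lt i]

lemma innerEnd_injOn (H : SortedEndpoints a b) (i : Fin n) : Set.InjOn (innerEnd a b i) (earlierOverlaps a b i) := by
  intro j hj k hk hjk
  by_contra hne
  by_cases hji : j = i
  · subst hji
    have h1 := H.innerEnd_mem hk (Ne.symm hne)
    have h2 : innerEnd a b j j = a j := by simp [innerEnd]
    omega
  by_cases hki : k = i
  · subst hki
    have h1 := H.innerEnd_mem hj hne
    have h2 : innerEnd a b k k = a k := by simp [innerEnd]
    omega
  have h1 := H.inj_left.ne hne
  have h2 := H.inj_right.ne hne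
  have h3 := H.left_ne_right j k
  have h4 := H.left_ne_right k j
  simp only [innerEnd, mem_coe.1 hj, mem_coe.1 hk, hji, hki, ne_eq, not_false_eq_true, and_self,
    if_true] at hjk
  split_ifs at hjk <;> omega

lemma pointPos_bounds (H : SortedEndpoints a b) (i : Fin n) (c : Bool ⊕ Fin n) :
    (n + 1) * a i ≤ pointPos a b i c ∧ pointPos a b i c ≤ (n + 1) * b i := by
  have hlt := H.lt i
  have hn := i.isLt
  rcases c with (_ | _) | j
  · simp only [pointPos]
    constructor <;> nlinarith
  · simp only [pointPos]
    constructor <;> nlinarith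
  · have := H.innerEnd_bounds i j
    simp only [pointPos]
    constructor <;> nlinarith

lemma pointPos_injective (H : SortedEndpoints a b) (x : Fin n → Bool ⊕ Fin n) :
    Function.Injective fun i => pointPos a b i (x i) := by
  have hdm : ∀ i, ∃ q t, pointPos a b i (x i) = (n + 1) * q + t ∧ t < n + 1 ∧
      (t = i + 1 ∨ t = 0 ∧ (q = a i ∨ q = b i)) := by
    intro i
    rcases x i with (_ | _) | j
    · exact ⟨b i, 0, by simp [pointPos], by omega, by simp⟩
    · exact ⟨a i, 0, by simp [pointPos], by omega, by simp⟩
    · exact ⟨innerEnd a b i j, i + 1, rfl, by omega, by simp⟩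
  intro i j hij
  obtain ⟨q, t, h1, h2, h3⟩ := hdm i
  obtain ⟨q', t', h1', h2', h3'⟩ := hdm j
  have heq : (n + 1) * q + t = (n + 1) * q' + t' := by rw [← h1, ← h1']; exact hij
  have hq : q = q' := by
    have := congrArg (· / (n + 1)) heq
    simpa [Nat.mul_add_div, Nat.div_eq_of_lt h2, Nat.div_eq_of_lt h2'] using this
  subst hq
  have ht : t = t' := by omega
  subst ht
  have hne := H.left_ne_right i j
  have hne' := H.left_ne_right j i
  rcases h3 with h3 | ⟨h3, h4⟩
  · exact Fin.ext (by omega)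
  · rcases h3' with h3' | ⟨_, h4'⟩
    · omega
    · rcases h4 with h4 | h4 <;> rcases h4' with h4' | h4'
      · exact H.inj_left (h4 ▸ h4')
      · omega
      · omega
      · exact H.inj_right (h4 ▸ h4')

lemma sum_pointWeight (H : SortedEndpoints a b) (i : Fin n) : ∑ c, pointWeight a b i c = 1 := by
  have h1 : (#(earlierOverlaps a b i) : ℝ) ≠ 0 := by
    exact_mod_cast (card_pos.2 ⟨i, H.self_mem i⟩).ne'
  rw [Fintype.sum_sum_type]
  simp only [pointWeight, sum_ite_mem, univ_inter, sum_const, nsmul_eq_mul, Finset.card_univ,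
    Fintype.card_bool]
  field_simp
  norm_num

/-- Only positions in one gap between the hits are consistent with a prescribed order, and the
weights of these, multiplied by the gains, sum to at most one. -/
lemma sum_consistent_le_one (H : SortedEndpoints a b) (i : Fin n) (x : Fin n → Bool ⊕ Fin n) (P : Fin n → Prop) :
    ∑ c, (if ∀ j < i, (pointPos a b j (x j) < pointPos a b i c ↔ P j) then
      pointWeight a b i c * gain a b i x c else 0) ≤ 1 := by
  set Q : Bool ⊕ Fin n → Prop := fun c => ∀ j < i, (pointPos a b j (x j) < pointPos a b i c ↔ P j)
    with hQ
  change ∑ c, (if Q c then pointWeight a b i c * gain a b i x c else 0) ≤ 1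
  have hhit : ∀ h ∈ hits a b i x, h < i ∧ a i < innerEnd a b i h ∧ innerEnd a b i h < b i ∧
      pointPos a b h (x h) = (n + 1) * innerEnd a b i h := by
    intro h hh
    obtain ⟨h1, h2, h3⟩ := pointPos_of_mem_hits hh
    have h4 := H.innerEnd_mem h1 h2
    exact ⟨lt_of_le_of_ne (mem_earlierOverlaps.1 h1).1 h2, h4.1, h4.2, h3⟩
  have hends : ∑ s : Bool, (if Q (.inl s) then
      pointWeight a b i (.inl s) * gain a b i x (.inl s) else 0) ≤ 3 / 4 := by
    rw [Fintype.sum_bool]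
    by_cases he : hits a b i x = ∅
    · simp only [pointWeight, gain, he, if_true]
      split_ifs <;> norm_num
    · obtain ⟨h, hh⟩ := nonempty_iff_ne_empty.2 he
      obtain ⟨h1, h2, h3, h4⟩ := hhit h hh
      have hnot : ¬(Q (.inl true) ∧ Q (.inl false)) := by
        rintro ⟨ht, hf⟩
        have e1 := ht h h1
        have e2 := hf h h1
        rw [h4] at e1 e2
        simp only [pointPos] at e1 e2
        have : (n + 1) * innerEnd a b i h < (n + 1) * a i :=
          e1.2 (e2.1 (Nat.mul_lt_mul_of_pos_left h3 (Nat.succ_pos n)))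
        nlinarith
      simp only [pointWeight, gain, he, if_false]
      split_ifs with q1 q2
      · exact absurd ⟨q1, q2⟩ hnot
      all_goals norm_num
  have hslots : ∑ j : Fin n, (if Q (.inr j) then
      pointWeight a b i (.inr j) * gain a b i x (.inr j) else 0) ≤ 1 / 4 := by
    set S := (earlierOverlaps a b i).filter fun j => Q (.inr j) with hS
    have hm : (0 : ℝ) < #(earlierOverlaps a b i) := by
      exact_mod_cast card_pos.2 ⟨i, H.self_mem i⟩
    have hsub : ∀ j ∈ S, S ⊆ cell a b i x j := by
      intro j hj k hk
      simp only [hS, mem_filter] at hj hk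
      simp only [cell, mem_filter]
      refine ⟨hk.1, fun h hh => ?_⟩
      obtain ⟨h1, h2, h3, h4⟩ := hhit h hh
      have hslot : ∀ k, pointPos a b h (x h) < pointPos a b i (.inr k) ↔
          ¬ innerEnd a b i k < innerEnd a b i h := by
        intro k
        rw [h4, not_lt]
        simp only [pointPos]
        have hi := i.isLt
        constructor
        · intro hlt
          by_contra hc
          nlinarith
        · intro hle
          nlinarith
      have e1 := hj.2 h h1
      have e2 := hk.2 h h1
      rw [hslot] at e1 e2
      exact not_iff_not.1 (e1.trans e2.symm)
    calc ∑ j : Fin n, (if Q (.inr j) then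
          pointWeight a b i (.inr j) * gain a b i x (.inr j) else 0)
        = ∑ j ∈ S, 1 / 4 * (1 / (#(cell a b i x j) : ℝ)) := by
          rw [hS, sum_filter, ← sum_filter_add_sum_filter_not univ (· ∈ earlierOverlaps a b i)]
          rw [sum_eq_zero (s := univ.filter (· ∉ earlierOverlaps a b i))]
          · rw [add_zero, filter_mem_eq_inter, univ_inter]
            refine sum_congr rfl fun j hj => ?_
            simp only [pointWeight, gain, hj, if_true]
            congr 1
            field_simp
          · intro j hj
            simp only [mem_filter, mem_univ, true_and] at hj
            simp [pointWeight, hj]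
      _ ≤ ∑ j ∈ S, 1 / 4 * (1 / (#S : ℝ)) := by
          refine sum_le_sum fun j hj => ?_
          have h1 : 0 < #S := card_pos.2 ⟨j, hj⟩
          have h2 := card_le_card (hsub j hj)
          gcongr
      _ ≤ 1 / 4 := by
          rw [sum_const, nsmul_eq_mul]
          rcases Nat.eq_zero_or_pos #S with h | h
          · simp [h]
          · field_simp
            rfl
  rw [Fintype.sum_sum_type]
  linarith

/-- The mean of the product of the gains is at most the number of linear extensions. -/
lemma productMean_prod_gain_le (H : SortedEndpoints a b) {l r : Fin n → ℝ} (hlr : ∀ i j, r i ≤ l j → b i < a j) :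
    productMean (pointWeight a b) (fun x => ∏ i, gain a b i x (x i)) ≤ numLinExt n l r := by
  rcases Nat.eq_zero_or_pos n with rfl | hn
  · simp [productMean, numLinExt]
  have : Nonempty (Bool ⊕ Fin n) := ⟨.inl true⟩
  let E := {σ : Equiv.Perm (Fin n) // ∀ i j : Fin n, r i ≤ l j → σ i < σ j}
  let f : E → Fin n → (Fin n → Bool ⊕ Fin n) → ℝ := fun σ i x =>
    if ∀ j < i, (pointPos a b j (x j) < pointPos a b i (x i) ↔ σ.1 j < σ.1 i) then
      pointWeight a b i (x i) * gain a b i x (x i) else 0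
  have hf0 : ∀ σ i x, 0 ≤ f σ i x := by
    intro σ i x
    simp only [f]
    split_ifs
    · exact mul_nonneg (pointWeight_nonneg _ _) (gain_pos _ _ _).le
    · rfl
  have hle : ∀ σ, ∑ x, ∏ i, f σ i x ≤ 1 := by
    intro σ
    refine sum_prod_adapted_le_one n (f σ) (hf0 σ) ?_ ?_
    · intro i x y hxy
      have hx : (∀ j < i, (pointPos a b j (x j) < pointPos a b i (x i) ↔ σ.1 j < σ.1 i)) ↔
          (∀ j < i, (pointPos a b j (y j) < pointPos a b i (y i) ↔ σ.1 j < σ.1 i)) := by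
        refine forall₂_congr fun j hj => ?_
        rw [hxy j hj.le, hxy i le_rfl]
      simp only [f, hx]
      rw [hxy i le_rfl, gain_congr fun j hj => hxy j (le_of_lt hj)]
    · intro i x
      refine le_trans (le_of_eq (sum_congr rfl fun c _ => ?_))
        (H.sum_consistent_le_one i x fun j => σ.1 j < σ.1 i)
      have hx : (∀ j < i, (pointPos a b j (Function.update x i c j) <
            pointPos a b i (Function.update x i c i) ↔ σ.1 j < σ.1 i)) ↔
          (∀ j < i, (pointPos a b j (x j) < pointPos a b i c ↔ σ.1 j < σ.1 i)) := by
        refine forall₂_congr fun j hj => ?_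
        rw [Function.update_of_ne hj.ne, Function.update_self]
      simp only [f]
      rw [if_congr hx rfl rfl, gain_update, Function.update_self]
      congr!
  have hex : ∀ x : Fin n → Bool ⊕ Fin n,
      (∏ i, pointWeight a b i (x i)) * ∏ i, gain a b i x (x i) ≤ ∑ σ : E, ∏ i, f σ i x := by
    intro x
    set p : Fin n → ℕ := fun i => pointPos a b i (x i) with hp
    have hpi : Function.Injective p := H.pointPos_injective x
    have hmono : StrictMono (p ∘ Tuple.sort p) :=
      (Tuple.monotone_sort p).strictMono_of_injective (hpi.comp (Tuple.sort p).injective)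
    have hσ : ∀ i j, (Tuple.sort p).symm i < (Tuple.sort p).symm j ↔ p i < p j := by
      intro i j
      rw [← hmono.lt_iff_lt]
      simp
    let σ : E := ⟨(Tuple.sort p).symm, fun i j hij => by
      rw [hσ]
      have h1 := (H.pointPos_bounds i (x i)).2
      have h2 := (H.pointPos_bounds j (x j)).1
      have h3 := hlr i j hij
      simp only [hp]
      nlinarith⟩
    refine le_trans (le_of_eq ?_) (single_le_sum (f := fun σ : E => ∏ i, f σ i x)
      (fun σ _ => prod_nonneg fun i _ => hf0 σ i x) (mem_univ σ))
    rw [← prod_mul_distrib]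
    refine prod_congr rfl fun i _ => ?_
    have : ∀ j < i, (pointPos a b j (x j) < pointPos a b i (x i) ↔ σ.1 j < σ.1 i) :=
      fun j _ => (hσ j i).symm
    simp only [f]
    rw [if_pos this]
  calc productMean (pointWeight a b) (fun x => ∏ i, gain a b i x (x i))
      ≤ ∑ x, ∑ σ : E, ∏ i, f σ i x := sum_le_sum fun x _ => hex x
    _ = ∑ σ : E, ∑ x, ∏ i, f σ i x := sum_comm
    _ ≤ ∑ _σ : E, (1 : ℝ) := sum_le_sum fun σ _ => hle σ
    _ = numLinExt n l r := by
        simp [numLinExt, E]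

/-- The mean logarithmic gain of the `i`-th interval. -/
lemma quarter_log_le_productMean_log_gain (H : SortedEndpoints a b) (i : Fin n) :
    Real.log #(earlierOverlaps a b i) / 4 ≤
      productMean (pointWeight a b) (fun x => Real.log (gain a b i x (x i))) := by
  set G := earlierOverlaps a b i with hG
  set μ := pointWeight a b with hμ
  have h0 : ∀ i c, 0 ≤ μ i c := pointWeight_nonneg
  have h1 : ∀ i, ∑ c, μ i c = 1 := H.sum_pointWeight
  have hm : 0 < #G := card_pos.2 ⟨i, H.self_mem i⟩
  have hmR : (0 : ℝ) < #G := by exact_mod_cast hm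
  have hmiss : ∀ B : Finset (Fin n),
      productMean μ (fun x => if ∀ h ∈ B, x h ≠ innerChoice a i h then 1 else 0)
        = (5 / 8) ^ #B := by
    intro B
    refine Eq.trans ?_ ((productMean_forall_ne h1 B (innerChoice a i) (3 / 8)
      fun h _ => rfl).trans (by norm_num))
    congr!
  have hcellpos : ∀ j ∈ G, ∀ x, (0 : ℝ) < #(cell a b i x j) := fun j hj x => by
    exact_mod_cast card_pos.2 ⟨j, self_mem_cell x hj⟩
  have hempty : productMean μ (fun x => if hits a b i x = ∅ then 1 else 0)
      = (5 / 8) ^ (#G - 1) := by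
    rw [← card_erase_of_mem (H.self_mem i), ← hmiss]
    congr 1
    funext x
    refine if_congr ?_ rfl rfl
    simp only [hits, filter_eq_empty_iff, ne_eq]
  have hcell : ∀ j ∈ G, productMean μ (fun x => (#(cell a b i x j) : ℝ)) ≤ 13 / 3 := by
    intro j hj
    refine le_trans (le_of_eq ?_)
      (sum_pow_card_separators_le G (innerEnd a b i) (H.innerEnd_injOn i) hj)
    have hc : ∀ x, (#(cell a b i x j) : ℝ) = ∑ k ∈ G,
        if ∀ h ∈ separators G (innerEnd a b i) j k, x h ≠ innerChoice a i h then (1 : ℝ) else 0 := by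
      intro x
      rw [cell, card_filter, Nat.cast_sum]
      refine sum_congr rfl fun k hk => ?_
      rw [Nat.cast_ite, Nat.cast_one, Nat.cast_zero]
      refine if_congr ?_ rfl rfl
      have hii : innerEnd a b i i = a i := by simp [innerEnd]
      have hbj := (H.innerEnd_bounds i j).1
      have hbk := (H.innerEnd_bounds i k).1
      constructor
      · intro hall h hh hx
        simp only [separators, mem_filter] at hh
        refine hh.2 (hall h ?_)
        simp only [hits, mem_filter, mem_erase]
        refine ⟨⟨?_, hh.1⟩, hx⟩
        rintro rfl
        exact hh.2 (by omega)
      · intro hall h hh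
        simp only [hits, mem_filter, mem_erase] at hh
        by_contra hc
        exact hall h (by simp only [separators, mem_filter]; exact ⟨hh.1.2, hc⟩) hh.2
    simp only [hc]
    rw [productMean_sum]
    refine sum_congr rfl fun k hk => hmiss _
  set T : ℝ := (∑ j ∈ G, productMean μ (fun x => Real.log #(cell a b i x j))) / #G with hT
  have hTle : ∀ u : ℝ, (∀ j ∈ G, productMean μ (fun x => Real.log #(cell a b i x j)) ≤ u) →
      T ≤ u := by
    intro u hu
    rw [hT, div_le_iff₀ hmR]
    refine (sum_le_sum hu).trans (le_of_eq ?_)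
    rw [sum_const, nsmul_eq_mul, mul_comm]
  have hT1 : T ≤ Real.log #G := by
    refine hTle _ fun j hj => ?_
    refine (productMean_mono h0 fun x => ?_).trans_eq (productMean_const h1 _)
    refine Real.log_le_log (hcellpos j hj x) ?_
    exact_mod_cast card_le_card (filter_subset _ _)
  have hT2 : T ≤ Real.log (13 / 3) := by
    refine hTle _ fun j hj => ?_
    refine (productMean_log_le h0 h1 (hcellpos j hj)).trans (Real.log_le_log ?_ (hcell j hj))
    have : productMean μ (fun _ => (1 : ℝ)) ≤ productMean μ (fun x => (#(cell a b i x j) : ℝ)) :=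
      productMean_mono h0 fun x => by
        exact_mod_cast card_pos.2 ⟨j, self_mem_cell x hj⟩
    rw [productMean_const h1] at this
    linarith
  refine (quarter_log_le #G hm T hT1 hT2).trans (le_of_eq ?_)
  rw [productMean_eq_productMean_update h1 i]
  have hinner : ∀ x, ∑ c, μ i c * Real.log (gain a b i (Function.update x i c)
        (Function.update x i c i))
      = (3 / 4 * Real.log 2 + Real.log #G / 4)
        + (-(3 / 4 * Real.log 2) * (if hits a b i x = ∅ then 1 else 0)
        + -(1 / (4 * #G)) * ∑ j ∈ G, Real.log #(cell a b i x j)) := by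
    intro x
    simp only [gain_update, Function.update_self]
    rw [Fintype.sum_sum_type]
    have e1 : ∑ s : Bool, μ i (.inl s) * Real.log (gain a b i x (.inl s))
        = 3 / 4 * Real.log 2 - 3 / 4 * Real.log 2 * (if hits a b i x = ∅ then 1 else 0) := by
      simp only [hμ, pointWeight, gain, Fintype.sum_bool]
      split_ifs
      · simp
      · ring
    have e2 : ∑ j : Fin n, μ i (.inr j) * Real.log (gain a b i x (.inr j))
        = ∑ j ∈ G, 1 / (4 * #G) * (Real.log #G - Real.log #(cell a b i x j)) := by
      rw [← sum_subset (subset_univ G)]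
      · refine sum_congr rfl fun j hj => ?_
        simp only [hμ, pointWeight, gain, ← hG, hj, if_true]
        rw [Real.log_div hmR.ne' (hcellpos j hj x).ne']
      · intro j _ hj
        simp [hμ, pointWeight, ← hG, hj]
    rw [e1, e2, ← mul_sum, sum_sub_distrib, sum_const, nsmul_eq_mul]
    field_simp
    ring
  simp only [hinner]
  rw [productMean_add, productMean_const h1, productMean_add, productMean_const_mul, hempty,
    productMean_const_mul, productMean_sum, hT]
  field_simp
  ring

lemma sum_log_card_le (H : SortedEndpoints a b) {l r : Fin n → ℝ} (hlr : ∀ i j, r i ≤ l j → b i < a j) :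
    ∑ i, Real.log #(earlierOverlaps a b i) ≤ 4 * Real.log (numLinExt n l r) := by
  set μ := pointWeight a b with hμ
  have h0 : ∀ i c, 0 ≤ μ i c := pointWeight_nonneg
  have h1 : ∀ i, ∑ c, μ i c = 1 := H.sum_pointWeight
  have hsum : productMean μ (fun x => Real.log (∏ i, gain a b i x (x i)))
      = ∑ i, productMean μ (fun x => Real.log (gain a b i x (x i))) := by
    rw [← productMean_sum]
    congr 1
    funext x
    exact Real.log_prod fun i _ => (gain_pos i x _).ne'
  have hjensen := productMean_log_le h0 h1 (F := fun x => ∏ i, gain a b i x (x i))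
    fun x => prod_pos fun i _ => gain_pos i x _
  have hpos : 0 < productMean μ (fun x => ∏ i, gain a b i x (x i)) := by
    obtain ⟨x, _, hx⟩ := exists_ne_zero_of_sum_ne_zero
      ((sum_prod_weight_eq_one h1).trans_ne one_ne_zero)
    have hx0 := lt_of_le_of_ne (prod_nonneg fun i _ => h0 i (x i)) hx.symm
    refine lt_of_lt_of_le (mul_pos hx0 (prod_pos fun i _ => gain_pos i x (x i)))
      (single_le_sum (f := fun x => (∏ i, μ i (x i)) * ∏ i, gain a b i x (x i))
        (fun y _ => mul_nonneg (prod_nonneg fun i _ => h0 i _)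
          (prod_nonneg fun i _ => (gain_pos i y _).le)) (mem_univ x))
  have hle := Real.log_le_log hpos (H.productMean_prod_gain_le hlr)
  have hq := sum_le_sum fun i (_ : i ∈ univ) => H.quarter_log_le_productMean_log_gain i
  rw [← sum_div] at hq
  linarith

end SortedEndpoints

/-! ### Ranks of the endpoints -/

/-- The key by which the endpoints are ranked: right endpoints precede left endpoints of the same
value, and remaining ties are broken by the index. -/
noncomputable def endpointKey {n : ℕ} (l r : Fin n → ℝ) : Bool × Fin n → ℝ ×ₗ Bool ×ₗ Fin n
  | (false, i) => toLex (r i, toLex (false, i))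
  | (true, i) => toLex (l i, toLex (true, i))

/-- The number of endpoints preceding the given one. -/
noncomputable def endpointRank {n : ℕ} (l r : Fin n → ℝ) (e : Bool × Fin n) : ℕ :=
  #{e' | endpointKey l r e' < endpointKey l r e}

lemma endpointKey_injective {n : ℕ} (l r : Fin n → ℝ) :
    Function.Injective (endpointKey l r) := by
  rintro ⟨_ | _, i⟩ ⟨_ | _, j⟩ h <;> simp_all [endpointKey]

lemma endpointRank_lt {n : ℕ} {l r : Fin n → ℝ} {e e' : Bool × Fin n}
    (h : endpointKey l r e < endpointKey l r e') : endpointRank l r e < endpointRank l r e' := by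
  refine card_lt_card ((ssubset_iff_of_subset fun x hx => ?_).2 ⟨e, ?_, ?_⟩)
  · simp only [mem_filter, mem_univ, true_and] at hx ⊢
    exact hx.trans h
  · simpa using h
  · simp

lemma endpointRank_injective {n : ℕ} (l r : Fin n → ℝ) :
    Function.Injective (endpointRank l r) := by
  intro e e' h
  by_contra hne
  rcases lt_or_gt_of_ne ((endpointKey_injective l r).ne hne) with h' | h'
  · exact (endpointRank_lt h').ne h
  · exact (endpointRank_lt h').ne' h

lemma endpointRank_left_lt_right {n : ℕ} {l r : Fin n → ℝ} {i j : Fin n} (h : l i < r j) :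
    endpointRank l r (true, i) < endpointRank l r (false, j) :=
  endpointRank_lt (by simp [endpointKey, Prod.Lex.toLex_lt_toLex, h])

lemma endpointRank_right_lt_left {n : ℕ} {l r : Fin n → ℝ} {i j : Fin n} (h : r i ≤ l j) :
    endpointRank l r (false, i) < endpointRank l r (true, j) := by
  refine endpointRank_lt ?_
  rcases h.lt_or_eq with h | h <;> simp [endpointKey, Prod.Lex.toLex_lt_toLex, h]

lemma numLinExt_comp_perm {n : ℕ} (l r : Fin n → ℝ) (π : Equiv.Perm (Fin n)) :
    numLinExt n (l ∘ π) (r ∘ π) = numLinExt n l r := by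
  refine Fintype.card_congr ((Equiv.equivCongr π (Equiv.refl _)).subtypeEquiv fun σ => ?_)
  constructor
  · intro h i j hij
    simpa using h (π.symm i) (π.symm j) (by simpa using hij)
  · intro h i j hij
    simpa using h (π i) (π j) hij

lemma exists_sorted_endpoints {n : ℕ} {l r : Fin n → ℝ} (hlr : ∀ i, l i < r i) :
    ∃ (π : Equiv.Perm (Fin n)) (a b : Fin n → ℕ), SortedEndpoints a b ∧
      (∀ i j, r (π i) ≤ l (π j) → b i < a j) ∧ (∀ i j, l (π i) < r (π j) → a i < b j) := by
  set a := fun i => endpointRank l r (true, i) with ha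
  set b := fun i => endpointRank l r (false, i) with hb
  have hab : ∀ i, a i < b i := fun i => endpointRank_left_lt_right (hlr i)
  set π := Tuple.sort fun i => b i - a i
  have hinj := endpointRank_injective l r
  refine ⟨π, a ∘ π, b ∘ π, ⟨fun i => hab _, ?_, ?_, ?_, ?_⟩, ?_, ?_⟩
  · exact Function.Injective.comp (fun i j h => (Prod.mk.inj (hinj h)).2) π.injective
  · exact Function.Injective.comp (fun i j h => (Prod.mk.inj (hinj h)).2) π.injective
  · intro i j h
    exact absurd (Prod.mk.inj (hinj h)).1 (by simp)
  · intro i j hij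
    have h1 := Tuple.monotone_sort (fun i => b i - a i) hij
    have h2 := hab (π i)
    have h3 := hab (π j)
    simp only [Function.comp_apply] at h1 ⊢
    change b (π i) - a (π i) ≤ b (π j) - a (π j) at h1
    omega
  · exact fun i j h => endpointRank_right_lt_left h
  · exact fun i j h => endpointRank_left_lt_right h

lemma piAmbiguity_le {n : ℕ} {l r : Fin n → ℝ} {a b : Fin n → ℕ} (H : SortedEndpoints a b)
    (hlt : ∀ i j, r i ≤ l j → b i < a j) (hle : ∀ i j, l i < r j → a i < b j) :
    piAmbiguity n l r ≤ 4 * Real.logb 2 (numLinExt n l r) := by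
  have hl2 : 0 < Real.log 2 := Real.log_pos (by norm_num)
  simp only [piAmbiguity, Real.logb, ← sum_div, ← mul_div_assoc]
  gcongr
  refine le_trans (sum_le_sum fun i _ => ?_) (H.sum_log_card_le hlt)
  have hsub : contact n l r i ⊆ earlierOverlaps a b i := by
    intro j hj
    simp only [contact, mem_filter, mem_univ, true_and] at hj
    obtain ⟨hji, x, hx1, hx2⟩ := hj
    exact mem_earlierOverlaps.2
      ⟨hji, hle _ _ (hx1.1.trans hx2.2), hle _ _ (hx2.1.trans hx1.2)⟩
  rcases Nat.eq_zero_or_pos #(contact n l r i) with h | h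
  · rw [h, Nat.cast_zero, Real.log_zero]
    exact Real.log_natCast_nonneg _
  · exact Real.log_le_log (by exact_mod_cast h) (by exact_mod_cast card_le_card hsub)

end AmbiguityBound

theorem stmt12 (n : ℕ) (hn : 1 ≤ n) (l r : Fin n → ℝ) (hlr : ∀ i, l i < r i) :
    ambiguity n l r ≤ 4 * Real.logb 2 ((numLinExt n l r : ℝ)) := by
  obtain ⟨π, a, b, H, hlt, hle⟩ := exists_sorted_endpoints hlr
  rw [← numLinExt_comp_perm l r π]
  exact (ciInf_le (Set.finite_range _).bddBelow π).trans (piAmbiguity_le H hlt hle)
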